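/- For all x, Δx ∈ ℝ², the one-sided exact inequality Re⟨v(x), v(x + Δx)⟩ ≥ 3(1 − α‖Δx‖²) holds; that is, the quadratic local-isometry profile is a global lower bound for the real part of the inner product. -/

import Mathlib

open Matrix RealInnerProductSpace

noncomputable section

/-- The map `e : ℝ² → ℂ³`, `e(x)ⱼ = exp(i⟨aⱼ, x⟩)`. -/
def gridE (a : Fin 3 → EuclideanSpace ℝ (Fin 2)) (x : EuclideanSpace ℝ (Fin 2)) :
    Fin 3 → ℂ :=
  fun j => Complex.exp (Complex.I * ((⟪a j, x⟫ : ℝ) : ℂ))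

/-- The diagonal matrix `D(Δx)` with diagonal entries `exp(i⟨aⱼ, Δx⟩)`. -/
def gridD (a : Fin 3 → EuclideanSpace ℝ (Fin 2)) (dx : EuclideanSpace ℝ (Fin 2)) :
    Matrix (Fin 3) (Fin 3) ℂ :=
  Matrix.diagonal (gridE a dx)

/-- `v(x) = C e(x)`. -/
def gridV (C : Matrix (Fin 3) (Fin 3) ℂ) (a : Fin 3 → EuclideanSpace ℝ (Fin 2))
    (x : EuclideanSpace ℝ (Fin 2)) : Fin 3 → ℂ :=
  C.mulVec (gridE a x)

/-- `M(Δx) = C D(Δx) C*`. -/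
def gridM (C : Matrix (Fin 3) (Fin 3) ℂ) (a : Fin 3 → EuclideanSpace ℝ (Fin 2))
    (dx : EuclideanSpace ℝ (Fin 2)) : Matrix (Fin 3) (Fin 3) ℂ :=
  C * gridD a dx * Cᴴ

/-- The Hermitian inner product `⟨u, w⟩ = u* w` on `ℂ³`,
conjugate-linear in the first argument. -/
def hermInner (u w : Fin 3 → ℂ) : ℂ :=
  ∑ j, star (u j) * w j

/-- An isometry `C` preserves the Hermitian inner product on `ℂ³`. -/
theorem hermInner_mulVec {C : Matrix (Fin 3) (Fin 3) ℂ} (hC : Cᴴ * C = 1)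
    (u w : Fin 3 → ℂ) : hermInner (C.mulVec u) (C.mulVec w) = hermInner u w := by
  change star (C.mulVec u) ⬝ᵥ C.mulVec w = star u ⬝ᵥ w
  rw [Matrix.star_mulVec, ← Matrix.dotProduct_mulVec, Matrix.mulVec_mulVec, hC,
    Matrix.one_mulVec]

theorem re_hermInner_gridE (a : Fin 3 → EuclideanSpace ℝ (Fin 2))
    (x dx : EuclideanSpace ℝ (Fin 2)) :
    (hermInner (gridE a x) (gridE a (x + dx))).re = ∑ j, Real.cos ⟪a j, dx⟫ := by
  have h (j : Fin 3) : star (gridE a x j) * gridE a (x + dx) j =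
      Complex.exp (((⟪a j, dx⟫ : ℝ) : ℂ) * Complex.I) := by
    simp only [gridE, Complex.star_def, ← Complex.exp_conj, ← Complex.exp_add, map_mul,
      Complex.conj_I, Complex.conj_ofReal, inner_add_right, Complex.ofReal_add]
    congr 1
    ring
  simp only [hermInner, h, Complex.re_sum, Complex.exp_ofReal_mul_I_re]

/-- The Gram determinant of three vectors in the plane vanishes. -/
theorem gram_det_eq_zero (u v w : EuclideanSpace ℝ (Fin 2)) :
    ⟪w, w⟫ * (⟪u, u⟫ * ⟪v, v⟫ - ⟪u, v⟫ ^ 2) =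
      ⟪u, u⟫ * ⟪v, w⟫ ^ 2 + ⟪v, v⟫ * ⟪u, w⟫ ^ 2 - 2 * ⟪u, v⟫ * ⟪u, w⟫ * ⟪v, w⟫ := by
  simp only [PiLp.inner_apply, Fin.sum_univ_two, RCLike.inner_apply, conj_trivial]
  ring

/-- Three planar vectors at mutual angles `2π/3` form a tight frame. -/
theorem sum_inner_sq_eq {α : ℝ} (hα : 0 < α) {a : Fin 3 → EuclideanSpace ℝ (Fin 2)}
    (hnorm : ∀ j, ‖a j‖ = 2 * Real.sqrt α)
    (hang : ∀ i j, i ≠ j → ⟪a i, a j⟫ = -2 * α) (d : EuclideanSpace ℝ (Fin 2)) :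
    ∑ j, ⟪a j, d⟫ ^ 2 = 6 * α * ‖d‖ ^ 2 := by
  have hself (j : Fin 3) : ⟪a j, a j⟫ = 4 * α := by
    rw [real_inner_self_eq_norm_sq, hnorm, mul_pow, Real.sq_sqrt hα.le]
    norm_num
  have hsum : a 0 + a 1 + a 2 = 0 := by
    rw [← inner_self_eq_zero (𝕜 := ℝ)]
    simp only [inner_add_left, inner_add_right, hself, hang 0 1 (by decide),
      hang 0 2 (by decide), hang 1 0 (by decide), hang 1 2 (by decide),
      hang 2 0 (by decide), hang 2 1 (by decide)]
    ring
  have h2 : ⟪a 0, d⟫ + ⟪a 1, d⟫ + ⟪a 2, d⟫ = 0 := by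
    rw [← inner_add_left, ← inner_add_left, hsum, inner_zero_left]
  have hg := gram_det_eq_zero (a 0) (a 1) d
  rw [hself, hself, hang 0 1 (by decide), real_inner_self_eq_norm_sq] at hg
  rw [Fin.sum_univ_three, eq_neg_of_add_eq_zero_right h2]
  apply mul_left_cancel₀ hα.ne'
  linear_combination -hg / 2

/-- the quadratic local-isometry profile is a global lower bound:
`Re⟨v(x), v(x+Δx)⟩ ≥ 3(1 − α‖Δx‖²)` for all `x, Δx`. -/
theorem grid_isometry_lower_bound (α : ℝ) (hα : 0 < α)
    (a : Fin 3 → EuclideanSpace ℝ (Fin 2))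
    (hnorm : ∀ j, ‖a j‖ = 2 * Real.sqrt α)
    (hang : ∀ i j, i ≠ j → ⟪a i, a j⟫ = -2 * α)
    (C : Matrix (Fin 3) (Fin 3) ℂ) (hC : Cᴴ * C = 1) :
    ∀ x dx : EuclideanSpace ℝ (Fin 2),
      (hermInner (gridV C a x) (gridV C a (x + dx))).re ≥ 3 * (1 - α * ‖dx‖ ^ 2) := by
  intro x dx
  have hcos : ∑ j, (1 - ⟪a j, dx⟫ ^ 2 / 2) ≤ ∑ j, Real.cos ⟪a j, dx⟫ :=
    Finset.sum_le_sum fun j _ => Real.one_sub_sq_div_two_le_cos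
  have hframe := sum_inner_sq_eq hα hnorm hang dx
  rw [gridV, gridV, hermInner_mulVec hC, re_hermInner_gridE]
  rw [Fin.sum_univ_three] at hcos hframe
  linarith
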